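/- Let H be a bipartite graph with t vertices whose minimal vertex cover has size q, let V_1,…,V_t be a partition of {1,…,n}, and let R' be the matrix with R'(A,B) = R_H(A,B) whenever A ∩ B = ∅, a_i ∈ V_i for all i, and b_j ∈ V_{x+j} for all j, and R'(A,B) = 0 otherwise. Then for every integer k ≥ 1, E[tr((R'·R'ᵀ)^k)] ≤ (tk)^{2(k−1)q}·n^{(t−q)k+q}. -/

import Mathlib

def sgn (b : Bool) : ℝ := if b then 1 else -1

noncomputable def Pr {n : ℕ} (P : (Sym2 (Fin n) → Bool) → Prop) : ℝ := by
  classical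
  exact ((Finset.univ.filter P).card : ℝ) / (Fintype.card (Sym2 (Fin n) → Bool))

noncomputable def Ex {n : ℕ} (f : (Sym2 (Fin n) → Bool) → ℝ) : ℝ :=
  (∑ g : Sym2 (Fin n) → Bool, f g) / (Fintype.card (Sym2 (Fin n) → Bool))

noncomputable def Rmat {n : ℕ} (g : Sym2 (Fin n) → Bool) : Matrix (Fin n) (Fin n) ℝ :=
  Matrix.of fun i j => if i = j then 0 else sgn (g s(i, j))

def cyc {m : ℕ} (j : Fin m) : Fin m := ⟨((j : ℕ) + 1) % m, Nat.mod_lt _ j.pos⟩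

abbrev SubsetsCard (n x : ℕ) := {A : Finset (Fin n) // A.card = x}

def tup {n x : ℕ} (A : SubsetsCard n x) (i : Fin x) : Fin n :=
  (A.1.orderIsoOfFin A.2 i : Fin n)

noncomputable def RH {n x y : ℕ} (E : Finset (Fin x × Fin y)) (g : Sym2 (Fin n) → Bool) :
    Matrix (SubsetsCard n x) (SubsetsCard n y) ℝ :=
  Matrix.of fun A B =>
    if Disjoint A.1 B.1 then ∏ e ∈ E, sgn (g s(tup A e.1, tup B e.2)) else 0

def IsVertexCover {x y : ℕ} (E : Finset (Fin x × Fin y)) (S : Finset (Fin x ⊕ Fin y)) : Prop :=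
  ∀ e ∈ E, Sum.inl e.1 ∈ S ∨ Sum.inr e.2 ∈ S

noncomputable def RHpart {n x y : ℕ} (E : Finset (Fin x × Fin y))
    (P : (Fin x ⊕ Fin y) → Finset (Fin n)) (g : Sym2 (Fin n) → Bool) :
    Matrix (SubsetsCard n x) (SubsetsCard n y) ℝ :=
  Matrix.of fun A B =>
    if Disjoint A.1 B.1 ∧ (∀ i, tup A i ∈ P (Sum.inl i)) ∧ (∀ j, tup B j ∈ P (Sum.inr j))
    then RH E g A B else 0

open Finset Function

/-- One side of a minimum vertex cover of a bipartite relation can be matched outside the cover. -/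
theorem exists_injective_of_minimal_cover {α β : Type*} [Fintype β]
    [DecidableEq α] [DecidableEq β] (r : α → β → Prop) (s : Finset α) (t : Finset β)
    (hcov : ∀ a b, r a b → a ∈ s ∨ b ∈ t)
    (hmin : ∀ (s' : Finset α) (t' : Finset β), (∀ a b, r a b → a ∈ s' ∨ b ∈ t') →
      #s + #t ≤ #s' + #t') :
    ∃ f : s → β, Injective f ∧ ∀ a : s, r a (f a) ∧ f a ∉ t := by
  classical
  refine (Fintype.all_card_le_filter_rel_iff_exists_injective
    fun (a : s) (b : β) => r a b ∧ b ∉ t).1 fun A => ?_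
  set N : Finset β := {b | ∃ a ∈ A, r a b ∧ b ∉ t}
  set A' : Finset α := A.map (Embedding.subtype _)
  have hA' : A' ⊆ s := fun a ha => by
    obtain ⟨b, -, rfl⟩ := mem_map.1 ha
    exact b.2
  have hcard : #A' = #A := card_map _
  have h := hmin (s \ A') (t ∪ N) fun a b hab => by
    rcases hcov a b hab with ha | hb
    · by_cases haA : a ∈ A'
      · right
        by_cases hb : b ∈ t
        · exact mem_union_left _ hb
        · obtain ⟨a', ha', rfl⟩ := mem_map.1 haA
          exact mem_union_right _ (mem_filter.2 ⟨mem_univ _, a', ha', hab, hb⟩)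
      · exact Or.inl (mem_sdiff.2 ⟨ha, haA⟩)
    · exact Or.inr (mem_union_left _ hb)
  have h1 := card_sdiff_add_card_eq_card hA'
  have h2 := card_union_le t N
  omega

/-- König's theorem: a minimum vertex cover `S` of a bipartite graph has as many vertices as some
matching has edges. -/
theorem exists_matching_of_minimal_cover {x y : ℕ} (E : Finset (Fin x × Fin y))
    (S : Finset (Fin x ⊕ Fin y)) (hS : IsVertexCover E S)
    (hmin : ∀ T, IsVertexCover E T → #S ≤ #T) :
    ∃ m : Fin #S → Fin x × Fin y, (∀ s, m s ∈ E) ∧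
      Injective (fun s => (m s).1) ∧ Injective (fun s => (m s).2) := by
  have hcov : ∀ a b, (a, b) ∈ E → a ∈ S.toLeft ∨ b ∈ S.toRight := fun a b h => by
    simpa using hS (a, b) h
  have hmin' : ∀ (s : Finset (Fin x)) (t : Finset (Fin y)),
      (∀ a b, (a, b) ∈ E → a ∈ s ∨ b ∈ t) → #S.toLeft + #S.toRight ≤ #s + #t := by
    intro s t h
    have := hmin (s.disjSum t) fun e he => by simpa using h e.1 e.2 he
    rwa [card_disjSum, ← card_toLeft_add_card_toRight] at this
  obtain ⟨f, hf, hfE⟩ := exists_injective_of_minimal_cover (fun a b => (a, b) ∈ E) _ _ hcov hmin'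
  obtain ⟨g, hg, hgE⟩ := exists_injective_of_minimal_cover (fun b a => (a, b) ∈ E)
    S.toRight S.toLeft (fun b a h => (hcov a b h).symm) fun t s h => by
      have := hmin' s t fun a b hab => (h b a hab).symm
      omega
  have hc : Fintype.card (S.toLeft ⊕ S.toRight) = #S := by
    rw [Fintype.card_sum, Fintype.card_coe, Fintype.card_coe, card_toLeft_add_card_toRight]
  let φ := (Fintype.equivFinOfCardEq hc).symm
  let m : S.toLeft ⊕ S.toRight → Fin x × Fin y :=
    Sum.elim (fun a => (a, f a)) (fun b => (g b, b))
  have hm₁ : Injective fun s => (m s).1 := by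
    rintro (a | b) (a' | b') h
    · exact congrArg _ (Subtype.ext h)
    · exact absurd (show (a : Fin x) = g b' from h) fun h' => (hgE b').2 (h' ▸ a.2)
    · exact absurd (show g b = (a' : Fin x) from h) fun h' => (hgE b).2 (h' ▸ a'.2)
    · exact congrArg _ (hg h)
  have hm₂ : Injective fun s => (m s).2 := by
    rintro (a | b) (a' | b') h
    · exact congrArg _ (hf h)
    · exact absurd (show f a = (b' : Fin y) from h) fun h' => (hfE a).2 (h' ▸ b'.2)
    · exact absurd (show (b : Fin y) = f a' from h) fun h' => (hfE a').2 (h' ▸ b.2)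
    · exact congrArg _ (Subtype.ext h)
  refine ⟨m ∘ φ, fun s => ?_, hm₁.comp φ.injective, hm₂.comp φ.injective⟩
  rcases h : φ s with a | b
  · simpa [m, h] using (hfE a).1
  · simpa [m, h] using (hgE b).1

/-- A walk visits at most one more vertex than it uses edges. -/
theorem card_image_walk_le {α : Type*} [DecidableEq α] (c : ℕ → α) (m : ℕ) :
    #((range (m + 1)).image c) ≤ #((range m).image fun j => s(c j, c (j + 1))) + 1 := by
  induction m with
  | zero => simp
  | succ m ih =>
    have hedge : (range (m + 1)).image (fun j => s(c j, c (j + 1))) =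
        insert s(c m, c (m + 1)) ((range m).image fun j => s(c j, c (j + 1))) := by
      rw [range_add_one, image_insert]
    rw [range_add_one (n := m + 1), image_insert, hedge]
    by_cases h : c (m + 1) ∈ (range (m + 1)).image c
    · rw [insert_eq_self.2 h]
      exact ih.trans (Nat.add_le_add_right (card_le_card (subset_insert _ _)) 1)
    · rw [card_insert_of_notMem h, card_insert_of_notMem]
      · omega
      · intro h'
        obtain ⟨j, hj, hjm⟩ := mem_image.1 h'
        have hj' := mem_range.1 hj
        apply h
        rcases Sym2.eq_iff.1 hjm with ⟨-, h2⟩ | ⟨h1, -⟩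
        · exact mem_image.2 ⟨j + 1, mem_range.2 (by omega), h2⟩
        · exact mem_image.2 ⟨j, mem_range.2 (by omega), h1⟩

/-- The edge traversed at a given step of the closed walk `a 0, b 0, a 1, b 1, …`. -/
def closedWalkEdge {α : Type*} {m : ℕ} (a b : Fin (m + 1) → α) (p : Fin (m + 1) × Bool) : Sym2 α :=
  s(a (if p.2 then finRotate (m + 1) p.1 else p.1), b p.1)

/-- A closed walk of length `2 * (m + 1)` using every edge an even number of times visits at most
`m + 2` vertices. -/
theorem card_image_le_of_even {α : Type*} [DecidableEq α] {m : ℕ} (a b : Fin (m + 1) → α)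
    (heven : ∀ z, Even #{p | closedWalkEdge a b p = z}) :
    #(univ.image (Sum.elim a b)) ≤ m + 2 := by
  let c : ℕ → α := fun j => if Even j then a (Fin.ofNat (m + 1) (j / 2))
    else b (Fin.ofNat (m + 1) (j / 2))
  have hce (i : ℕ) : c (2 * i) = a (Fin.ofNat (m + 1) i) := by simp [c]
  have hco (i : ℕ) : c (2 * i + 1) = b (Fin.ofNat (m + 1) i) := by
    have : (2 * i + 1) / 2 = i := by omega
    simp [c, this]
  have hverts : univ.image (Sum.elim a b) ⊆ (range (2 * (m + 1) + 1)).image c := by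
    intro v hv
    obtain ⟨i | i, -, rfl⟩ := mem_image.1 hv
    · exact mem_image.2 ⟨2 * i, mem_range.2 (by omega), by simp [hce]⟩
    · exact mem_image.2 ⟨2 * i + 1, mem_range.2 (by omega), by simp [hco]⟩
  have hedges : (range (2 * (m + 1))).image (fun j => s(c j, c (j + 1))) ⊆
      univ.image (closedWalkEdge a b) := by
    intro z hz
    obtain ⟨j, -, rfl⟩ := mem_image.1 hz
    obtain ⟨i, rfl | rfl⟩ := Nat.even_or_odd' j
    · exact mem_image.2 ⟨(Fin.ofNat (m + 1) i, false), mem_univ _, by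
        simp [closedWalkEdge, hce, hco]⟩
    · refine mem_image.2 ⟨(Fin.ofNat (m + 1) i, true), mem_univ _, ?_⟩
      have h : 2 * i + 1 + 1 = 2 * (i + 1) := by ring
      have h' : Fin.ofNat (m + 1) (i + 1) = Fin.ofNat (m + 1) i + 1 := by ext; simp [Fin.val_add]
      rw [h, hce, hco, h', Sym2.eq_swap]
      simp [closedWalkEdge]
  have htwice : 2 * #(univ.image (closedWalkEdge a b)) ≤ #(univ : Finset (Fin (m + 1) × Bool)) := by
    refine mul_card_image_le_card _ 2 fun z hz => ?_
    obtain ⟨p, -, hp⟩ := mem_image.1 hz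
    have hpos : 0 < #{p | closedWalkEdge a b p = z} :=
      card_pos.2 ⟨p, mem_filter.2 ⟨mem_univ _, hp⟩⟩
    obtain ⟨l, hl⟩ := heven z
    omega
  have h1 := card_le_card hverts
  have h2 := card_image_walk_le c (2 * (m + 1))
  have h3 := card_le_card hedges
  simp only [card_univ, Fintype.card_prod, Fintype.card_fin, Fintype.card_bool] at htwice
  omega

/-- Functions on `r + d` points taking at most `r` values. -/
theorem card_functions_few_values_le {ι α : Type*} [Fintype ι] [DecidableEq ι] [Fintype α]
    [DecidableEq α] (r d : ℕ) (hι : Fintype.card ι = r + d) :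
    #{c : ι → α | #(univ.image c) ≤ r} ≤
      Fintype.card ι ^ (2 * d) * Fintype.card α ^ r := by
  classical
  let I : Finset ((Fin d → ι) × (Fin d → ι)) :=
    {p | Injective p.1 ∧ ∀ l, p.2 l ∉ univ.image p.1}
  let D : (Fin d → ι) × (Fin d → ι) → Finset (ι → α) := fun p => {c | ∀ l, c (p.1 l) = c (p.2 l)}
  have hsub : ({c : ι → α | #(univ.image c) ≤ r} : Finset _) ⊆ I.biUnion D := by
    intro c hc
    have hc := (mem_filter.1 hc).2
    obtain ⟨u, -, hinj, hu⟩ := exists_subset_injOn_image_eq_of_surjOn (f := c)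
      Set.univ (univ.image c) (fun v hv => by simpa using hv)
    obtain ⟨T, huT, hT⟩ := exists_superset_card_eq (s := u) (n := r)
      (by rw [← card_image_of_injOn hinj, hu]; exact hc) (by omega)
    have hTc : #Tᶜ = d := by rw [card_compl]; omega
    have hrep (j : ι) : ∃ i ∈ T, c j = c i := by
      have : c j ∈ u.image c := hu ▸ mem_image_of_mem _ (mem_univ j)
      obtain ⟨i, hi, h⟩ := mem_image.1 this
      exact ⟨i, huT hi, h.symm⟩
    choose ρ hρT hρ using hrep
    let e : Fin d ≃ (Tᶜ : Finset ι) := (Tᶜ.equivFinOfCardEq hTc).symm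
    refine mem_biUnion.2 ⟨(fun l => e l, fun l => ρ (e l)), mem_filter.2 ⟨mem_univ _, ?_, ?_⟩,
      mem_filter.2 ⟨mem_univ _, fun l => hρ _⟩⟩
    · exact Subtype.val_injective.comp e.injective
    · intro l hl
      obtain ⟨l', -, h⟩ := mem_image.1 hl
      have h : (e l' : ι) = ρ (e l) := h
      exact mem_compl.1 (e l').2 (h ▸ hρT _)
  have hD : ∀ p ∈ I, #(D p) ≤ Fintype.card α ^ r := by
    intro p hp
    obtain ⟨-, hpinj, hp⟩ := mem_filter.1 hp
    have hcard : Fintype.card {j // j ∉ univ.image p.1} = r := by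
      rw [Fintype.card_subtype_compl, Fintype.card_coe, card_image_of_injective _ hpinj]
      simp [hι]
    rw [← hcard, ← Fintype.card_fun, ← card_univ]
    refine card_le_card_of_injOn (fun c j => c j) (fun _ _ => mem_univ _) ?_
    intro c hc c' hc' h
    have hc := (mem_filter.1 hc).2
    have hc' := (mem_filter.1 hc').2
    have hout : ∀ j, j ∉ univ.image p.1 → c j = c' j := fun j hj => congrFun h ⟨j, hj⟩
    funext j
    by_cases hj : j ∈ univ.image p.1
    · obtain ⟨l, -, rfl⟩ := mem_image.1 hj
      rw [hc, hc', hout _ (hp l)]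
    · exact hout j hj
  calc _ ≤ #(I.biUnion D) := card_le_card hsub
    _ ≤ #I * Fintype.card α ^ r := card_biUnion_le_card_mul _ _ _ hD
    _ ≤ _ := by
      refine Nat.mul_le_mul_right _ ((card_le_univ I).trans (le_of_eq ?_))
      simp [two_mul, pow_add]

/-- Counting functions on `V` whose values on `q` disjoint pairs of points are constrained. -/
theorem card_functions_matched_le {V F : Type*} [Fintype V] [DecidableEq V] [Fintype F]
    [DecidableEq F] {q : ℕ} (u v : Fin q → V) (huv : Injective (Sum.elim u v))
    (W : Finset (F × F)) :
    #{C : V → F | ∀ s, (C (u s), C (v s)) ∈ W} ≤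
      #W ^ q * Fintype.card F ^ (Fintype.card V - 2 * q) := by
  have hcard : Fintype.card {w // w ∉ univ.image (Sum.elim u v)} = Fintype.card V - 2 * q := by
    rw [Fintype.card_subtype_compl, Fintype.card_coe, card_image_of_injective _ huv]
    simp [two_mul]
  have htarget : #((Fintype.piFinset fun _ : Fin q => W) ×ˢ
      (univ : Finset ({w // w ∉ univ.image (Sum.elim u v)} → F))) =
      #W ^ q * Fintype.card F ^ (Fintype.card V - 2 * q) := by
    rw [card_product, Fintype.card_piFinset_const, card_univ, Fintype.card_fun, hcard]
  rw [← htarget]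
  refine card_le_card_of_injOn (fun C => (fun s => (C (u s), C (v s)), fun w => C w)) ?_ ?_
  · intro C hC
    exact mem_product.2 ⟨Fintype.mem_piFinset.2 (mem_filter.1 hC).2, mem_univ _⟩
  · intro C _ C' _ h
    obtain ⟨h1, h2⟩ := Prod.mk.inj h
    funext w
    by_cases hw : w ∈ univ.image (Sum.elim u v)
    · obtain ⟨s | s, -, rfl⟩ := mem_image.1 hw
      · exact (Prod.mk.inj (congrFun h1 s)).1
      · exact (Prod.mk.inj (congrFun h1 s)).2
    · exact congrFun h2 ⟨w, hw⟩

/-- Entries of matrix powers as sums over walks. -/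
theorem matrix_pow_succ_apply_eq_sum {ι R : Type*} [Fintype ι] [DecidableEq ι] [CommSemiring R]
    (M : Matrix ι ι R) (m : ℕ) (i j : ι) :
    (M ^ (m + 1)) i j = ∑ p : Fin m → ι, ∏ s : Fin (m + 1),
      M (Fin.cons (α := fun _ => ι) i p s) (Fin.snoc (α := fun _ => ι) p j s) := by
  induction m generalizing i with
  | zero => simp [Fin.snoc]
  | succ m ih =>
    rw [pow_succ', Matrix.mul_apply, ← (Fin.consEquiv fun _ : Fin (m + 1) => ι).sum_comp,
      Fintype.sum_prod_type]
    refine sum_congr rfl fun l _ => ?_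
    rw [ih, mul_sum]
    refine sum_congr rfl fun p _ => ?_
    rw [Fin.prod_univ_succ (n := m + 1)]
    have h : (Fin.snoc (Fin.consEquiv (fun _ => ι) (l, p)) j : Fin (m + 2) → ι) =
        Fin.cons l (Fin.snoc p j) := (Fin.cons_snoc_eq_snoc_cons l p j).symm
    rw [h]
    simp only [Fin.consEquiv_apply, Fin.cons_zero, Fin.cons_succ]

/-- Traces of matrix powers as sums over closed walks. -/
theorem matrix_trace_pow_succ_eq_sum {ι R : Type*} [Fintype ι] [DecidableEq ι] [CommSemiring R]
    (M : Matrix ι ι R) (m : ℕ) :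
    (M ^ (m + 1)).trace =
      ∑ A : Fin (m + 1) → ι, ∏ s, M (A s) (A (finRotate (m + 1) s)) := by
  rw [Matrix.trace, ← (Fin.consEquiv fun _ : Fin (m + 1) => ι).sum_comp, Fintype.sum_prod_type]
  refine sum_congr rfl fun i _ => ?_
  rw [Matrix.diag_apply, matrix_pow_succ_apply_eq_sum]
  simp only [Fin.consEquiv_apply, Fin.snoc_eq_cons_rotate]

/-- Traces of powers of `M * Mᵀ` as sums over closed alternating walks. -/
theorem matrix_trace_mul_transpose_pow_succ_eq_sum {ι κ R : Type*} [Fintype ι] [DecidableEq ι]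
    [Fintype κ] [DecidableEq κ] [CommSemiring R] (M : Matrix ι κ R) (m : ℕ) :
    ((M * M.transpose) ^ (m + 1)).trace =
      ∑ A : Fin (m + 1) → ι, ∑ B : Fin (m + 1) → κ,
        ∏ s, M (A s) (B s) * M (A (finRotate (m + 1) s)) (B s) := by
  rw [matrix_trace_pow_succ_eq_sum]
  refine sum_congr rfl fun A _ => ?_
  simp only [Matrix.mul_apply, Matrix.transpose_apply]
  rw [prod_univ_sum, Fintype.piFinset_univ]

theorem sgn_not (b : Bool) : sgn (!b) = -sgn b := by cases b <;> simp [sgn]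

theorem abs_sgn (b : Bool) : |sgn b| = 1 := by cases b <;> simp [sgn]

theorem Ex_sum {n : ℕ} {ι : Type*} (s : Finset ι) (f : ι → (Sym2 (Fin n) → Bool) → ℝ) :
    Ex (fun g => ∑ i ∈ s, f i g) = ∑ i ∈ s, Ex (f i) := by
  simp only [Ex]
  rw [sum_comm, sum_div]

/-- A product of signs in which some pair occurs an odd number of times has mean zero. -/
theorem Ex_prod_sgn_eq_zero {n : ℕ} {τ : Type*} (T : Finset τ) (w : τ → Sym2 (Fin n))
    (z : Sym2 (Fin n)) (hz : Odd #{t ∈ T | w t = z}) :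
    Ex (fun g => ∏ t ∈ T, sgn (g (w t))) = 0 := by
  rw [Ex, div_eq_zero_iff]
  left
  have hflip (g : Sym2 (Fin n) → Bool) :
      ∏ t ∈ T, sgn (update g z (!g z) (w t)) = -∏ t ∈ T, sgn (g (w t)) := by
    have h (t : τ) : sgn (update g z (!g z) (w t)) =
        (if w t = z then -1 else 1) * sgn (g (w t)) := by
      by_cases ht : w t = z
      · simp [ht, sgn_not]
      · simp [ht]
    simp only [h]
    rw [prod_mul_distrib, prod_ite, prod_const, prod_const_one, hz.neg_one_pow]
    ring
  refine sum_involution (fun g _ => update g z (!g z)) (fun g _ => by rw [hflip]; ring) ?_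
    (fun _ _ => mem_univ _) (fun g _ => by simp)
  intro g _ _ h
  have := congrFun h z
  simp at this

/-- A product of signs has mean at most one. -/
theorem Ex_prod_sgn_le_one {n : ℕ} {τ : Type*} (T : Finset τ) (w : τ → Sym2 (Fin n)) :
    Ex (fun g => ∏ t ∈ T, sgn (g (w t))) ≤ 1 := by
  rw [Ex]
  refine div_le_one_of_le₀ ?_ (Nat.cast_nonneg _)
  calc _ ≤ ∑ _g : Sym2 (Fin n) → Bool, (1 : ℝ) := by
        refine sum_le_sum fun g _ => (le_abs_self _).trans ?_
        rw [abs_prod]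
        simp [abs_sgn]
    _ = _ := by simp

theorem tup_injective {n x : ℕ} : Injective (tup : SubsetsCard n x → Fin x → Fin n) := by
  intro A A' h
  apply Subtype.ext
  ext v
  have key (A : SubsetsCard n x) : v ∈ A.1 ↔ ∃ i, tup A i = v := by
    constructor
    · intro hv
      exact ⟨(A.1.orderIsoOfFin A.2).symm ⟨v, hv⟩, by simp [tup]⟩
    · rintro ⟨i, rfl⟩
      exact (A.1.orderIsoOfFin A.2 i).2
  rw [key, key, h]

/-- The coordinates of a closed walk `A 0, B 0, A 1, B 1, …` on the row and column indices. -/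
def walkCoordinates {n x y k : ℕ} (A : Fin k → SubsetsCard n x) (B : Fin k → SubsetsCard n y) :
    Fin x ⊕ Fin y → Fin k → Fin n :=
  Sum.elim (fun i s => tup (A s) i) (fun j s => tup (B s) j)

theorem walkCoordinates_injective {n x y k : ℕ} : Injective fun
    p : (Fin k → SubsetsCard n x) × (Fin k → SubsetsCard n y) => walkCoordinates p.1 p.2 := by
  rintro ⟨A, B⟩ ⟨A', B'⟩ h
  refine Prod.ext (funext fun s => tup_injective (funext fun i => ?_))
    (funext fun s => tup_injective (funext fun j => ?_))
  · exact congrFun (congrFun h (Sum.inl i)) s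
  · exact congrFun (congrFun h (Sum.inr j)) s

/-- The pairs traversed along different edges of `H` differ when coordinates lie in disjoint
classes. -/
theorem closedWalkEdge_ne {n x y m : ℕ} {P : (Fin x ⊕ Fin y) → Finset (Fin n)}
    (hP : ∀ a b, a ≠ b → Disjoint (P a) (P b)) {C : Fin x ⊕ Fin y → Fin (m + 1) → Fin n}
    (hC : ∀ v s, C v s ∈ P v) {e e' : Fin x × Fin y} (p p' : Fin (m + 1) × Bool)
    (h : closedWalkEdge (C (Sum.inl e.1)) (C (Sum.inr e.2)) p =
      closedWalkEdge (C (Sum.inl e'.1)) (C (Sum.inr e'.2)) p') : e = e' := by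
  have huniq {v v' : Fin x ⊕ Fin y} {s s' : Fin (m + 1)} (h : C v s = C v' s') : v = v' := by
    by_contra hne
    exact disjoint_left.1 (hP _ _ hne) (hC v s) (h ▸ hC v' s')
  rcases Sym2.eq_iff.1 h with ⟨h1, h2⟩ | ⟨h1, -⟩
  · exact Prod.ext (Sum.inl_injective (huniq h1)) (Sum.inr_injective (huniq h2))
  · exact absurd (huniq h1) Sum.inl_ne_inr

open Classical in
/-- The contribution of a closed walk to the expected trace is at most one, and vanishes unless
every edge of `H` traces out a closed walk using every pair an even number of times. -/
theorem Ex_walk_le {n x y m : ℕ} (E : Finset (Fin x × Fin y))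
    (P : (Fin x ⊕ Fin y) → Finset (Fin n)) (hP : ∀ a b, a ≠ b → Disjoint (P a) (P b))
    (A : Fin (m + 1) → SubsetsCard n x) (B : Fin (m + 1) → SubsetsCard n y) :
    Ex (fun g => ∏ s, RHpart E P g (A s) (B s) * RHpart E P g (A (finRotate (m + 1) s)) (B s)) ≤
      if ∀ e ∈ E, ∀ z, Even #{p | closedWalkEdge (walkCoordinates A B (Sum.inl e.1))
        (walkCoordinates A B (Sum.inr e.2)) p = z} then 1 else 0 := by
  by_cases hadm : ∀ p : Fin (m + 1) × Bool,
      let A' := A (if p.2 then finRotate (m + 1) p.1 else p.1)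
      Disjoint A'.1 (B p.1).1 ∧ (∀ i, tup A' i ∈ P (Sum.inl i)) ∧
        (∀ j, tup (B p.1) j ∈ P (Sum.inr j))
  · have hC : ∀ v s, walkCoordinates A B v s ∈ P v := by
      rintro (i | j) s
      · exact (hadm (s, false)).2.1 i
      · exact (hadm (s, false)).2.2 j
    let w : (Fin (m + 1) × Bool) × (Fin x × Fin y) → Sym2 (Fin n) := fun t =>
      closedWalkEdge (walkCoordinates A B (Sum.inl t.2.1)) (walkCoordinates A B (Sum.inr t.2.2)) t.1
    have hprod (g : Sym2 (Fin n) → Bool) :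
        ∏ s, RHpart E P g (A s) (B s) * RHpart E P g (A (finRotate (m + 1) s)) (B s) =
          ∏ t ∈ univ ×ˢ E, sgn (g (w t)) := by
      have hentry (p : Fin (m + 1) × Bool) :
          RHpart E P g (A (if p.2 then finRotate (m + 1) p.1 else p.1)) (B p.1) =
            ∏ e ∈ E, sgn (g (w (p, e))) := by
        rw [RHpart, Matrix.of_apply, if_pos (hadm p), RH, Matrix.of_apply, if_pos (hadm p).1]
        rfl
      rw [prod_product]
      simp only [← hentry]
      rw [Fintype.prod_prod_type]
      simp [mul_comm]
    simp only [hprod]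
    split_ifs with hgood
    · exact Ex_prod_sgn_le_one _ _
    · push Not at hgood
      obtain ⟨e, he, z, hz⟩ := hgood
      refine (Ex_prod_sgn_eq_zero _ _ z ?_).le
      obtain ⟨p₀, hp₀⟩ : ∃ p₀, w (p₀, e) = z := by
        by_contra! hne
        rw [filter_eq_empty_iff.2 fun p _ => hne p] at hz
        simp at hz
      rw [← card_image_of_injective _ (Prod.mk_left_injective e), Nat.not_even_iff_odd] at hz
      convert hz using 2
      ext ⟨p, e'⟩
      constructor
      · intro h
        have h := (mem_filter.1 h).2
        obtain rfl : e = e' := closedWalkEdge_ne hP hC p₀ p (hp₀.trans h.symm)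
        exact mem_image.2 ⟨p, mem_filter.2 ⟨mem_univ _, h⟩, rfl⟩
      · intro h
        obtain ⟨p', hp', h⟩ := mem_image.1 h
        obtain ⟨rfl, rfl⟩ := Prod.mk.inj h
        exact mem_filter.2 ⟨mem_product.2 ⟨mem_univ _, he⟩, (mem_filter.1 hp').2⟩
  · obtain ⟨⟨s, c⟩, hs⟩ := not_forall.1 hadm
    have hzero (g : Sym2 (Fin n) → Bool) :
        ∏ s, RHpart E P g (A s) (B s) * RHpart E P g (A (finRotate (m + 1) s)) (B s) = 0 := by
      refine prod_eq_zero (mem_univ s) ?_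
      have : RHpart E P g (A (if c then finRotate (m + 1) s else s)) (B s) = 0 := by
        rw [RHpart, Matrix.of_apply, if_neg hs]
      cases c
      · exact mul_eq_zero_of_left this _
      · exact mul_eq_zero_of_right _ this
    simp only [hzero]
    have : Ex (fun _ : Sym2 (Fin n) → Bool => 0) = 0 := by simp [Ex]
    rw [this]
    split_ifs <;> norm_num

theorem stmt12 (n x y q k : ℕ) (hn : 1 ≤ n) (hk : 1 ≤ k)
    (E : Finset (Fin x × Fin y))
    (hq : IsLeast {m | ∃ S : Finset (Fin x ⊕ Fin y), IsVertexCover E S ∧ S.card = m} q)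
    (P : (Fin x ⊕ Fin y) → Finset (Fin n))
    (hPdisj : ∀ a b, a ≠ b → Disjoint (P a) (P b))
    (hPcov : ∀ v : Fin n, ∃ a, v ∈ P a) :
    Ex (fun g => Matrix.trace ((RHpart E P g * (RHpart E P g).transpose) ^ k))
      ≤ ((((x + y) * k) ^ (2 * (k - 1) * q) * n ^ ((x + y - q) * k + q) : ℕ) : ℝ) := by
  classical
  obtain ⟨m, rfl⟩ : ∃ m, k = m + 1 := ⟨k - 1, by omega⟩
  obtain ⟨⟨S, hS, hSq⟩, hmin⟩ := hq
  have hmatch := exists_matching_of_minimal_cover E S hS fun T hT => hSq ▸ hmin ⟨T, hT, rfl⟩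
  rw [hSq] at hmatch
  obtain ⟨μ, hμE, hμ₁, hμ₂⟩ := hmatch
  let W : Finset ((Fin (m + 1) → Fin n) × (Fin (m + 1) → Fin n)) :=
    {c | #(univ.image (Sum.elim c.1 c.2)) ≤ m + 2}
  let Good : (Fin (m + 1) → SubsetsCard n x) × (Fin (m + 1) → SubsetsCard n y) → Prop := fun p =>
    ∀ e ∈ E, ∀ z, Even #{t | closedWalkEdge (walkCoordinates p.1 p.2 (Sum.inl e.1))
        (walkCoordinates p.1 p.2 (Sum.inr e.2)) t = z}
  have hW : #W ≤ (2 * (m + 1)) ^ (2 * m) * n ^ (m + 2) := by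
    have h := card_functions_few_values_le (ι := Fin (m + 1) ⊕ Fin (m + 1)) (α := Fin n) (m + 2) m
      (by simp; omega)
    simp only [Fintype.card_sum, Fintype.card_fin, ← two_mul] at h
    refine le_trans ?_ h
    refine card_le_card_of_injOn (fun c => Sum.elim c.1 c.2) (fun c hc => ?_) ?_
    · exact mem_filter.2 ⟨mem_univ _, (mem_filter.1 hc).2⟩
    · intro c _ c' _ h
      exact Prod.ext (funext fun s => congrFun h (Sum.inl s))
        (funext fun s => congrFun h (Sum.inr s))
  have hinj : Injective (Sum.elim (fun s => (Sum.inl (μ s).1 : Fin x ⊕ Fin y))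
      (fun s => Sum.inr (μ s).2)) :=
    (Sum.inl_injective.comp hμ₁).sumElim (Sum.inr_injective.comp hμ₂) fun _ _ => Sum.inl_ne_inr
  have h2q : 2 * q ≤ x + y := by
    simpa [two_mul] using Fintype.card_le_of_injective _ hinj
  have hcount : #{p | Good p} ≤ #W ^ q * (n ^ (m + 1)) ^ (x + y - 2 * q) := by
    have h := card_functions_matched_le _ _ hinj W
    simp only [Fintype.card_sum, Fintype.card_fin, Fintype.card_fun] at h
    refine le_trans (card_le_card_of_injOn _ (fun p hp => ?_) walkCoordinates_injective.injOn) h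
    exact mem_filter.2 ⟨mem_univ _, fun s => mem_filter.2 ⟨mem_univ _,
      card_image_le_of_even _ _ ((mem_filter.1 hp).2 _ (hμE s))⟩⟩
  have hbound : #W ^ q * (n ^ (m + 1)) ^ (x + y - 2 * q) ≤
      ((x + y) * (m + 1)) ^ (2 * (m + 1 - 1) * q) * n ^ ((x + y - q) * (m + 1) + q) := by
    have hexp : (x + y - q) * (m + 1) + q = (m + 2) * q + (m + 1) * (x + y - 2 * q) := by
      obtain ⟨d, hd⟩ := Nat.exists_eq_add_of_le h2q
      have h1 : x + y - q = q + d := by omega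
      have h2 : x + y - 2 * q = d := by omega
      rw [h1, h2]
      ring
    have hbase : (2 * (m + 1)) ^ (2 * m * q) ≤ ((x + y) * (m + 1)) ^ (2 * m * q) := by
      rcases Nat.eq_zero_or_pos q with h0 | hpos
      · simp [h0]
      · exact Nat.pow_le_pow_left (Nat.mul_le_mul_right _ (by omega)) _
    calc _ ≤ ((2 * (m + 1)) ^ (2 * m) * n ^ (m + 2)) ^ q * (n ^ (m + 1)) ^ (x + y - 2 * q) :=
          Nat.mul_le_mul_right _ (Nat.pow_le_pow_left hW _)
      _ = (2 * (m + 1)) ^ (2 * m * q) * n ^ ((x + y - q) * (m + 1) + q) := by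
          rw [hexp, mul_pow, ← pow_mul, ← pow_mul, ← pow_mul, pow_add, mul_assoc]
      _ ≤ _ := Nat.mul_le_mul_right _ hbase
  calc _ = ∑ p : (Fin (m + 1) → SubsetsCard n x) × (Fin (m + 1) → SubsetsCard n y),
          Ex (fun g => ∏ s, RHpart E P g (p.1 s) (p.2 s) *
            RHpart E P g (p.1 (finRotate (m + 1) s)) (p.2 s)) := by
        simp only [matrix_trace_mul_transpose_pow_succ_eq_sum, Ex_sum, Fintype.sum_prod_type]
    _ ≤ ∑ p, if Good p then 1 else 0 := by
        refine sum_le_sum fun p _ => (Ex_walk_le E P hPdisj p.1 p.2).trans (le_of_eq ?_)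
        congr
    _ = (#{p | Good p} : ℝ) := by rw [sum_boole]
    _ ≤ _ := Nat.cast_le.2 (hcount.trans hbound)
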